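/- arXiv:hep-th/0006106 — 2 statements merged into one kernel-verified Lean document; each statement's English description precedes it below -/
import Mathlib

section
/- (W is a projector.) The Epstein–Glaser subtraction operator W is idempotent on smooth functions: for every smooth φ : ℝ^d → ℝ one has W(Wφ) = Wφ, equivalently W ∘ (id − W) = 0, i.e. W ∘ S = 0. -/
open Finset

/-- The partial derivative `∂ᵢ` of a function on `ℝ^d`. -/
noncomputable def pderivFun {d : ℕ} (i : Fin d) (f : (Fin d → ℝ) → ℝ) : (Fin d → ℝ) → ℝ :=
  fun x => fderiv ℝ f x (Pi.single i 1)

/-- The iterated partial derivative `∂_a` associated to a multi-index `a : Fin d → ℕ`. -/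
noncomputable def mderiv {d : ℕ} (a : Fin d → ℕ) (f : (Fin d → ℝ) → ℝ) : (Fin d → ℝ) → ℝ :=
  (List.finRange d).foldr (fun i g => (pderivFun i)^[a i] g) f

/-- The Epstein–Glaser subtraction operator `W = W_{ω,w}`:
`(Wφ)(x) = φ(x) − w(x) Σ_{|a| ≤ ω} (x^a / a!) ∂_aφ(0)`. -/
noncomputable def EGsub (d ω : ℕ) (w φ : (Fin d → ℝ) → ℝ) : (Fin d → ℝ) → ℝ :=
  fun x => φ x - w x *
    ∑ a ∈ Finset.univ.filter (fun a : Fin d → Fin (ω + 1) => (∑ i, ((a i : ℕ))) ≤ ω),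
      ((∏ i, x i ^ (a i : ℕ)) / ((∏ i, Nat.factorial (a i : ℕ) : ℕ) : ℝ)) *
        mderiv (fun i => (a i : ℕ)) φ 0

/-- `w` is an admissible auxiliary function of order `ω`: it is smooth, `w(0) = 1`, and
`∂_a w(0) = 0` for all multi-indices `a` with `1 ≤ |a| ≤ ω`. -/
def IsAdmissible (d ω : ℕ) (w : (Fin d → ℝ) → ℝ) : Prop :=
  ContDiff ℝ (⊤ : ℕ∞) w ∧ w 0 = 1 ∧
    ∀ a : Fin d → ℕ, 1 ≤ ∑ i, a i → (∑ i, a i) ≤ ω → mderiv a w 0 = 0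

section PartialDerivatives

variable {d : ℕ}

theorem ContDiff.pderivFun {f : (Fin d → ℝ) → ℝ} (hf : ContDiff ℝ (⊤ : ℕ∞) f) (i : Fin d) :
    ContDiff ℝ (⊤ : ℕ∞) (pderivFun i f) :=
  (hf.fderiv_right (m := (⊤ : ℕ∞)) (by simp)).clm_apply contDiff_const

theorem ContDiff.pderivFun_iterate {f : (Fin d → ℝ) → ℝ} (hf : ContDiff ℝ (⊤ : ℕ∞) f)
    (i : Fin d) (k : ℕ) : ContDiff ℝ (⊤ : ℕ∞) ((_root_.pderivFun i)^[k] f) := by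
  induction k with
  | zero => exact hf
  | succ k ih => rw [Function.iterate_succ_apply']; exact ih.pderivFun i

theorem pderivFun_add {f g : (Fin d → ℝ) → ℝ} (hf : ContDiff ℝ (⊤ : ℕ∞) f)
    (hg : ContDiff ℝ (⊤ : ℕ∞) g) (i : Fin d) :
    pderivFun i (f + g) = pderivFun i f + pderivFun i g := by
  funext x
  simp [pderivFun, fderiv_add (hf.differentiable (by simp) x) (hg.differentiable (by simp) x)]

theorem pderivFun_smul (c : ℝ) (f : (Fin d → ℝ) → ℝ) (i : Fin d) :
    pderivFun i (c • f) = c • pderivFun i f := by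
  funext x
  simp [pderivFun, fderiv_const_smul_field]

theorem pderivFun_mul {f g : (Fin d → ℝ) → ℝ} (hf : ContDiff ℝ (⊤ : ℕ∞) f)
    (hg : ContDiff ℝ (⊤ : ℕ∞) g) (i : Fin d) :
    pderivFun i (f * g) = pderivFun i f * g + f * pderivFun i g := by
  funext x
  simp [pderivFun, fderiv_mul (hf.differentiable (by simp) x) (hg.differentiable (by simp) x)]
  ring

theorem pderivFun_comm {f : (Fin d → ℝ) → ℝ} (hf : ContDiff ℝ (⊤ : ℕ∞) f) (i j : Fin d) :
    pderivFun i (pderivFun j f) = pderivFun j (pderivFun i f) := by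
  have hdiff : Differentiable ℝ (fderiv ℝ f) :=
    (hf.fderiv_right (m := (⊤ : ℕ∞)) (by simp)).differentiable (by simp)
  have key : ∀ k l : Fin d, ∀ x, pderivFun k (pderivFun l f) x =
      fderiv ℝ (fderiv ℝ f) x (Pi.single k 1) (Pi.single l 1) := by
    intro k l x
    have h : HasFDerivAt (pderivFun l f) _ x := (hdiff x).hasFDerivAt.clm_apply
      (hasFDerivAt_const (Pi.single l (1 : ℝ) : Fin d → ℝ) x)
    rw [pderivFun, h.fderiv]
    simp
  funext x
  rw [key, key]
  exact (hf.contDiffAt.isSymmSndFDerivAt (by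
    rw [minSmoothness_of_isRCLikeNormedField]
    exact WithTop.coe_le_coe.2 (le_top : (2 : ℕ∞) ≤ ⊤))).eq _ _

theorem pderivFun_iterate_comm {f : (Fin d → ℝ) → ℝ} (hf : ContDiff ℝ (⊤ : ℕ∞) f)
    (i j : Fin d) (k : ℕ) :
    (pderivFun i)^[k] (pderivFun j f) = pderivFun j ((pderivFun i)^[k] f) := by
  induction k with
  | zero => rfl
  | succ k ih =>
    rw [Function.iterate_succ_apply', Function.iterate_succ_apply', ih,
      pderivFun_comm (hf.pderivFun_iterate i k)]

theorem ContDiff.const_smul_fun {f : (Fin d → ℝ) → ℝ} (hf : ContDiff ℝ (⊤ : ℕ∞) f) (c : ℝ) :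
    ContDiff ℝ (⊤ : ℕ∞) (c • f) := hf.const_smul c

/-- The iterated partial derivative whose orders are read off along a list of indices. -/
noncomputable def listDeriv (l : List (Fin d)) (a : Fin d → ℕ) (f : (Fin d → ℝ) → ℝ) :
    (Fin d → ℝ) → ℝ :=
  l.foldr (fun i g => (pderivFun i)^[a i] g) f

theorem listDeriv_cons (i : Fin d) (l : List (Fin d)) (a : Fin d → ℕ) (f : (Fin d → ℝ) → ℝ) :
    listDeriv (i :: l) a f = (pderivFun i)^[a i] (listDeriv l a f) := rfl

theorem ContDiff.listDeriv {f : (Fin d → ℝ) → ℝ} (hf : ContDiff ℝ (⊤ : ℕ∞) f)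
    (l : List (Fin d)) (a : Fin d → ℕ) : ContDiff ℝ (⊤ : ℕ∞) (listDeriv l a f) := by
  induction l with
  | nil => exact hf
  | cons i l ih => exact ih.pderivFun_iterate i (a i)

theorem listDeriv_pderivFun {f : (Fin d → ℝ) → ℝ} (hf : ContDiff ℝ (⊤ : ℕ∞) f)
    (l : List (Fin d)) (a : Fin d → ℕ) (i : Fin d) :
    listDeriv l a (pderivFun i f) = pderivFun i (listDeriv l a f) := by
  induction l with
  | nil => rfl
  | cons j l ih =>
    rw [listDeriv_cons, ih, pderivFun_iterate_comm (hf.listDeriv l a), listDeriv_cons]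

theorem listDeriv_congr {l : List (Fin d)} {a b : Fin d → ℕ} (h : ∀ i ∈ l, a i = b i)
    (f : (Fin d → ℝ) → ℝ) : listDeriv l a f = listDeriv l b f := by
  induction l with
  | nil => rfl
  | cons i l ih =>
    rw [listDeriv_cons, listDeriv_cons, h i (by simp),
      ih fun j hj => h j (List.mem_cons_of_mem _ hj)]

theorem listDeriv_add_single {f : (Fin d → ℝ) → ℝ} (hf : ContDiff ℝ (⊤ : ℕ∞) f)
    {l : List (Fin d)} (hl : l.Nodup) (a : Fin d → ℕ) {i : Fin d} (hi : i ∈ l) :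
    listDeriv l (a + Pi.single i 1) f = pderivFun i (listDeriv l a f) := by
  induction l with
  | nil => simp at hi
  | cons j l ih =>
    obtain ⟨hj, hl'⟩ := List.nodup_cons.1 hl
    rw [listDeriv_cons, listDeriv_cons]
    by_cases hij : i = j
    · subst hij
      have hcongr : listDeriv l (a + Pi.single i 1) f = listDeriv l a f := by
        refine listDeriv_congr (fun k hk => ?_) f
        have hki : k ≠ i := fun h => hj (h ▸ hk)
        simp [hki]
      rw [hcongr, ← Function.iterate_succ_apply' (pderivFun i)]
      simp
    · have hil : i ∈ l := (List.mem_cons.1 hi).resolve_left hij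
      rw [ih hl' hil, pderivFun_iterate_comm (hf.listDeriv l a)]
      have hji : j ≠ i := Ne.symm hij
      simp [hji]

theorem mderiv_pderivFun {f : (Fin d → ℝ) → ℝ} (hf : ContDiff ℝ (⊤ : ℕ∞) f)
    (a : Fin d → ℕ) (i : Fin d) : mderiv a (pderivFun i f) = mderiv (a + Pi.single i 1) f :=
  (listDeriv_pderivFun hf _ a i).trans
    (listDeriv_add_single hf (List.nodup_finRange d) a (List.mem_finRange i)).symm

theorem pderivFun_iterate_add {f g : (Fin d → ℝ) → ℝ} (hf : ContDiff ℝ (⊤ : ℕ∞) f)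
    (hg : ContDiff ℝ (⊤ : ℕ∞) g) (i : Fin d) (k : ℕ) :
    (pderivFun i)^[k] (f + g) = (pderivFun i)^[k] f + (pderivFun i)^[k] g := by
  induction k with
  | zero => rfl
  | succ k ih =>
    simp only [Function.iterate_succ_apply', ih]
    exact pderivFun_add (hf.pderivFun_iterate i k) (hg.pderivFun_iterate i k) i

theorem pderivFun_iterate_smul (c : ℝ) (f : (Fin d → ℝ) → ℝ) (i : Fin d) (k : ℕ) :
    (pderivFun i)^[k] (c • f) = c • (pderivFun i)^[k] f := by
  induction k with
  | zero => rfl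
  | succ k ih => simp only [Function.iterate_succ_apply', ih, pderivFun_smul]

theorem mderiv_add {f g : (Fin d → ℝ) → ℝ} (hf : ContDiff ℝ (⊤ : ℕ∞) f)
    (hg : ContDiff ℝ (⊤ : ℕ∞) g) (a : Fin d → ℕ) :
    mderiv a (f + g) = mderiv a f + mderiv a g := by
  suffices ∀ l : List (Fin d), listDeriv l a (f + g) = listDeriv l a f + listDeriv l a g from
    this _
  intro l
  induction l with
  | nil => rfl
  | cons i l ih =>
    simp only [listDeriv_cons, ih]
    exact pderivFun_iterate_add (hf.listDeriv l a) (hg.listDeriv l a) i _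

theorem mderiv_smul (c : ℝ) (f : (Fin d → ℝ) → ℝ) (a : Fin d → ℕ) :
    mderiv a (c • f) = c • mderiv a f := by
  suffices ∀ l : List (Fin d), listDeriv l a (c • f) = c • listDeriv l a f from this _
  intro l
  induction l with
  | nil => rfl
  | cons i l ih => simp only [listDeriv_cons, ih, pderivFun_iterate_smul]

theorem mderiv_sum {ι : Type*} (s : Finset ι) (f : ι → (Fin d → ℝ) → ℝ)
    (hf : ∀ j, ContDiff ℝ (⊤ : ℕ∞) (f j)) (a : Fin d → ℕ) :
    mderiv a (∑ j ∈ s, f j) = ∑ j ∈ s, mderiv a (f j) := by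
  classical
  induction s using Finset.induction_on with
  | empty => simpa using mderiv_smul 0 (0 : (Fin d → ℝ) → ℝ) a
  | insert j s hj ih =>
    have hsum : ContDiff ℝ (⊤ : ℕ∞) (∑ j ∈ s, f j) := by
      simpa only [Finset.sum_fn] using ContDiff.sum fun j _ => hf j
    rw [Finset.sum_insert hj, Finset.sum_insert hj, mderiv_add (hf j) hsum, ih]

/-- All partial derivatives of `f` of order at most `n` vanish at the origin. -/
def FlatAtZero : ℕ → ((Fin d → ℝ) → ℝ) → Prop
  | 0, f => f 0 = 0
  | n + 1, f => f 0 = 0 ∧ ∀ i, FlatAtZero n (pderivFun i f)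

theorem FlatAtZero.apply_zero {n : ℕ} {f : (Fin d → ℝ) → ℝ} (hf : FlatAtZero n f) :
    f 0 = 0 := by
  cases n with
  | zero => exact hf
  | succ n => exact hf.1

theorem FlatAtZero.of_succ {n : ℕ} {f : (Fin d → ℝ) → ℝ} (hf : FlatAtZero (n + 1) f) :
    FlatAtZero n f := by
  induction n generalizing f with
  | zero => exact hf.1
  | succ n ih => exact ⟨hf.1, fun i => ih (hf.2 i)⟩

theorem FlatAtZero.add {n : ℕ} {f g : (Fin d → ℝ) → ℝ} (hf : FlatAtZero n f)
    (hg : FlatAtZero n g) (hfs : ContDiff ℝ (⊤ : ℕ∞) f) (hgs : ContDiff ℝ (⊤ : ℕ∞) g) :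
    FlatAtZero n (f + g) := by
  induction n generalizing f g with
  | zero => simp_all [FlatAtZero]
  | succ n ih =>
    refine ⟨by simp [hf.1, hg.1], fun i => ?_⟩
    rw [pderivFun_add hfs hgs]
    exact ih (hf.2 i) (hg.2 i) (hfs.pderivFun i) (hgs.pderivFun i)

theorem FlatAtZero.mul {n : ℕ} {f g : (Fin d → ℝ) → ℝ} (hf : FlatAtZero n f)
    (hfs : ContDiff ℝ (⊤ : ℕ∞) f) (hgs : ContDiff ℝ (⊤ : ℕ∞) g) :
    FlatAtZero n (f * g) := by
  induction n generalizing f g with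
  | zero => simp_all [FlatAtZero]
  | succ n ih =>
    refine ⟨by simp [hf.1], fun i => ?_⟩
    rw [pderivFun_mul hfs hgs]
    exact (ih (hf.2 i) (hfs.pderivFun i) hgs).add (ih hf.of_succ hfs (hgs.pderivFun i))
      ((hfs.pderivFun i).mul hgs) (hfs.mul (hgs.pderivFun i))

theorem FlatAtZero.pderivFun_iterate {n : ℕ} {f : (Fin d → ℝ) → ℝ} (i : Fin d) (k : ℕ)
    (hf : FlatAtZero (n + k) f) : FlatAtZero n ((pderivFun i)^[k] f) := by
  induction k generalizing f with
  | zero => exact hf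
  | succ k ih => exact ih (hf.2 i)

theorem FlatAtZero.listDeriv {n : ℕ} {f : (Fin d → ℝ) → ℝ} (l : List (Fin d))
    (a : Fin d → ℕ) (hf : FlatAtZero (n + (l.map a).sum) f) :
    FlatAtZero n (listDeriv l a f) := by
  induction l generalizing n with
  | nil => exact hf
  | cons i l ih =>
    refine FlatAtZero.pderivFun_iterate i (a i) (ih ?_)
    simpa [add_assoc] using hf

theorem FlatAtZero.mderiv_eq_zero {n : ℕ} {f : (Fin d → ℝ) → ℝ} (hf : FlatAtZero n f)
    {a : Fin d → ℕ} (ha : ∑ i, a i ≤ n) : mderiv a f 0 = 0 := by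
  refine (FlatAtZero.listDeriv (n := n - ∑ i, a i) (List.finRange d) a ?_).apply_zero
  rwa [← List.ofFn_eq_map, List.sum_ofFn, Nat.sub_add_cancel ha]

theorem mderiv_zero (f : (Fin d → ℝ) → ℝ) : mderiv 0 f = f := by
  suffices ∀ l : List (Fin d), listDeriv l 0 f = f from this _
  intro l
  induction l with
  | nil => rfl
  | cons i l ih => simp [listDeriv_cons, ih]

theorem flatAtZero_of_mderiv_eq_zero {n : ℕ} {f : (Fin d → ℝ) → ℝ}
    (hfs : ContDiff ℝ (⊤ : ℕ∞) f) (hf : ∀ a : Fin d → ℕ, ∑ i, a i ≤ n → mderiv a f 0 = 0) :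
    FlatAtZero n f := by
  have h0 : f 0 = 0 := by simpa [mderiv_zero] using hf 0 (by simp)
  induction n generalizing f with
  | zero => exact h0
  | succ n ih =>
    refine ⟨h0, fun i => ?_⟩
    have hi : ∀ a : Fin d → ℕ, ∑ j, a j ≤ n → mderiv a (pderivFun i f) 0 = 0 := by
      intro a ha
      rw [mderiv_pderivFun hfs]
      exact hf _ (by simpa [Finset.sum_add_distrib] using ha)
    exact ih (hfs.pderivFun i) hi (by simpa [mderiv_zero] using hi 0 (by simp))

/-- The monomial function `x ↦ x^a`. -/
def monomialFun (a : Fin d → ℕ) : (Fin d → ℝ) → ℝ := fun x => ∏ i, x i ^ a i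

theorem contDiff_monomialFun (a : Fin d → ℕ) : ContDiff ℝ (⊤ : ℕ∞) (monomialFun a) := by
  unfold monomialFun
  fun_prop

theorem pderivFun_monomialFun (a : Fin d → ℕ) (i : Fin d) :
    pderivFun i (monomialFun a) = (a i : ℝ) • monomialFun (a - Pi.single i 1) := by
  funext x
  have h : HasFDerivAt (monomialFun a) _ x := HasFDerivAt.finsetProd
    (u := Finset.univ) fun j _ => (hasFDerivAt_apply (𝕜 := ℝ) j x).pow (a j)
  rw [pderivFun, h.fderiv]
  have hprod : monomialFun (a - Pi.single i 1) x =
      x i ^ (a i - 1) * ∏ j ∈ Finset.univ.erase i, x j ^ a j := by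
    rw [monomialFun, ← Finset.mul_prod_erase _ _ (Finset.mem_univ i)]
    congr 1
    · simp
    · exact Finset.prod_congr rfl fun j hj => by simp [Finset.ne_of_mem_erase hj]
  rw [Pi.smul_apply, hprod]
  simp [Pi.single_apply]
  ring

theorem pderivFun_iterate_monomialFun (a : Fin d → ℕ) (i : Fin d) (k : ℕ) :
    (pderivFun i)^[k] (monomialFun a) =
      ((a i).descFactorial k : ℝ) • monomialFun (a - Pi.single i k) := by
  induction k with
  | zero => simp
  | succ k ih =>
    rw [Function.iterate_succ_apply', ih, pderivFun_smul, pderivFun_monomialFun, smul_smul,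
      Nat.descFactorial_succ, tsub_tsub, ← Pi.single_add]
    simp [mul_comm]

theorem listDeriv_monomialFun (a b : Fin d → ℕ) {l : List (Fin d)} (hl : l.Nodup) :
    listDeriv l b (monomialFun a) =
      (∏ i ∈ l.toFinset, ((a i).descFactorial (b i) : ℝ)) •
        monomialFun (fun i => if i ∈ l then a i - b i else a i) := by
  induction l with
  | nil => simp [listDeriv]
  | cons i l ih =>
    obtain ⟨hi, hl'⟩ := List.nodup_cons.1 hl
    rw [listDeriv_cons, ih hl', pderivFun_iterate_smul, pderivFun_iterate_monomialFun,
      smul_smul, List.toFinset_cons, Finset.prod_insert (by simpa using hi), mul_comm, if_neg hi]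
    congr 2
    funext j
    by_cases hj : j = i
    · subst hj; simp [hi]
    · simp [hj]

theorem mderiv_monomialFun_zero (a b : Fin d → ℕ) :
    mderiv b (monomialFun a) 0 = if a = b then ((∏ i, (b i).factorial : ℕ) : ℝ) else 0 := by
  have h : mderiv b (monomialFun a) 0 =
      ∏ i, ((a i).descFactorial (b i) : ℝ) * 0 ^ (a i - b i) := by
    refine (congrFun (listDeriv_monomialFun a b (List.nodup_finRange d)) 0).trans ?_
    simp [monomialFun, Finset.prod_mul_distrib]
  rw [h]
  split_ifs with hab
  · simp [hab, Nat.descFactorial_self]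
  · obtain ⟨i, hi⟩ := Function.ne_iff.1 hab
    refine Finset.prod_eq_zero (Finset.mem_univ i) ?_
    rcases hi.lt_or_gt with hlt | hgt
    · simp [Nat.descFactorial_eq_zero_iff_lt.2 hlt]
    · simp [Nat.sub_ne_zero_of_lt hgt]

theorem mderiv_one {a : Fin d → ℕ} (ha : a ≠ 0) : mderiv a (1 : (Fin d → ℝ) → ℝ) 0 = 0 := by
  have h : monomialFun 0 = (1 : (Fin d → ℝ) → ℝ) := by funext x; simp [monomialFun]
  rw [← h, mderiv_monomialFun_zero, if_neg ha.symm]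

end PartialDerivatives

theorem IsAdmissible.flatAtZero_sub_one {d ω : ℕ} {w : (Fin d → ℝ) → ℝ}
    (hw : IsAdmissible d ω w) : FlatAtZero ω (w + (-1 : ℝ) • 1) := by
  have hone : ContDiff ℝ (⊤ : ℕ∞) ((-1 : ℝ) • (1 : (Fin d → ℝ) → ℝ)) :=
    ContDiff.const_smul_fun contDiff_const (-1)
  refine flatAtZero_of_mderiv_eq_zero (hw.1.add hone) fun a ha => ?_
  by_cases h0 : a = 0
  · simp [h0, mderiv_zero, hw.2.1]
  · have hpos : 1 ≤ ∑ i, a i := by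
      rw [Nat.one_le_iff_ne_zero]
      exact fun h => h0 (funext fun i => by simpa using Finset.sum_eq_zero_iff.1 h i)
    rw [mderiv_add hw.1 hone, mderiv_smul]
    simp [hw.2.2 a hpos ha, mderiv_one h0]

/-- The Taylor polynomial of order `ω` of `φ` at the origin. -/
noncomputable def taylorPoly (d ω : ℕ) (φ : (Fin d → ℝ) → ℝ) : (Fin d → ℝ) → ℝ :=
  ∑ a ∈ Finset.univ.filter (fun a : Fin d → Fin (ω + 1) => (∑ i, ((a i : ℕ))) ≤ ω),
    (mderiv (fun i => (a i : ℕ)) φ 0 / ((∏ i, Nat.factorial (a i : ℕ) : ℕ) : ℝ)) •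
      monomialFun (fun i => (a i : ℕ))

theorem contDiff_taylorPoly (d ω : ℕ) (φ : (Fin d → ℝ) → ℝ) :
    ContDiff ℝ (⊤ : ℕ∞) (taylorPoly d ω φ) := by
  unfold taylorPoly
  simpa only [Finset.sum_fn] using
    ContDiff.sum fun (a : Fin d → Fin (ω + 1)) _ =>
      (contDiff_monomialFun fun i => (a i : ℕ)).const_smul_fun _

theorem mderiv_taylorPoly {d ω : ℕ} (φ : (Fin d → ℝ) → ℝ) {b : Fin d → Fin (ω + 1)}
    (hb : ∑ i, (b i : ℕ) ≤ ω) :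
    mderiv (fun i => (b i : ℕ)) (taylorPoly d ω φ) 0 = mderiv (fun i => (b i : ℕ)) φ 0 := by
  rw [taylorPoly, mderiv_sum _ _ fun a => (contDiff_monomialFun _).const_smul_fun _,
    Finset.sum_apply, Finset.sum_eq_single b]
  · have hne : ((∏ i, (b i : ℕ).factorial : ℕ) : ℝ) ≠ 0 :=
      Nat.cast_ne_zero.2 (Finset.prod_ne_zero_iff.2 fun i _ => Nat.factorial_ne_zero _)
    rw [mderiv_smul, Pi.smul_apply, mderiv_monomialFun_zero, if_pos rfl, smul_eq_mul,
      div_mul_cancel₀ _ hne]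
  · intro a _ hab
    have hne : (fun i => (a i : ℕ)) ≠ fun i => (b i : ℕ) :=
      fun h => hab (funext fun i => Fin.ext (congrFun h i))
    rw [mderiv_smul, Pi.smul_apply, mderiv_monomialFun_zero, if_neg hne, smul_zero]
  · intro h
    exact absurd (by simpa using hb) h

theorem EGsub_eq (d ω : ℕ) (w φ : (Fin d → ℝ) → ℝ) :
    EGsub d ω w φ = φ + (-1 : ℝ) • (w * taylorPoly d ω φ) := by
  funext x
  simp only [EGsub, taylorPoly, monomialFun, Pi.add_apply, Pi.smul_apply, Pi.mul_apply,
    Finset.sum_apply, smul_eq_mul, neg_one_mul, ← sub_eq_add_neg]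
  congr 2
  exact Finset.sum_congr rfl fun a _ => by ring

theorem mderiv_EGsub_eq_zero {d ω : ℕ} {w φ : (Fin d → ℝ) → ℝ} (hw : IsAdmissible d ω w)
    (hφ : ContDiff ℝ (⊤ : ℕ∞) φ) {b : Fin d → Fin (ω + 1)} (hb : ∑ i, (b i : ℕ) ≤ ω) :
    mderiv (fun i => (b i : ℕ)) (EGsub d ω w φ) 0 = 0 := by
  have hT := contDiff_taylorPoly d ω φ
  have hv : ContDiff ℝ (⊤ : ℕ∞) (w + (-1 : ℝ) • 1) := 
    hw.1.add (ContDiff.const_smul_fun contDiff_const (-1))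
  have hwT : ContDiff ℝ (⊤ : ℕ∞) (w * taylorPoly d ω φ) := hw.1.mul hT
  have hvT : ContDiff ℝ (⊤ : ℕ∞) ((w + (-1 : ℝ) • 1) * taylorPoly d ω φ) := hv.mul hT
  have hsplit : w * taylorPoly d ω φ =
      taylorPoly d ω φ + (w + (-1 : ℝ) • 1) * taylorPoly d ω φ := by
    funext x
    simp only [Pi.mul_apply, Pi.add_apply, Pi.smul_apply, Pi.one_apply, smul_eq_mul]
    ring
  rw [EGsub_eq, mderiv_add hφ (hwT.const_smul_fun (-1)), mderiv_smul, hsplit,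
    mderiv_add hT hvT]
  simp only [Pi.add_apply, Pi.smul_apply, mderiv_taylorPoly φ hb,
    (hw.flatAtZero_sub_one.mul hv hT).mderiv_eq_zero hb]
  simp

/-- `W` is a projector: `W(Wφ) = Wφ` for every smooth `φ`. -/
theorem EGsub_idem (d ω : ℕ) (hd : 1 ≤ d) (w : (Fin d → ℝ) → ℝ) (hw : IsAdmissible d ω w)
    (φ : (Fin d → ℝ) → ℝ) (hφ : ContDiff ℝ (⊤ : ℕ∞) φ) :
    EGsub d ω w (EGsub d ω w φ) = EGsub d ω w φ := by
  funext x
  rw [EGsub]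
  rw [Finset.sum_eq_zero, mul_zero, sub_zero]
  intro a ha
  rw [mderiv_EGsub_eq_zero hw hφ (Finset.mem_filter.1 ha).2, mul_zero]
end

section
/- (Scaling degree and smooth cutoffs.) Let f ∈ 𝒮'(ℝⁿ) and let g : ℝⁿ → ℝ be a smooth compactly supported function (such a g automatically has scaling degree ≤ 0), and define g·f ∈ 𝒮'(ℝⁿ) by ⟨g·f, φ⟩ := ⟨f, gφ⟩. If s ∈ ℝ is a scaling bound for f, then s is a scaling bound for g·f; consequently σ(g·f) ≤ σ(f). -/
open SchwartzMap Filter Topology Set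

noncomputable section

/-- `ℝⁿ` with the Euclidean norm. -/
abbrev Eucl (n : ℕ) := EuclideanSpace ℝ (Fin n)

/-- The continuous linear equivalence `x ↦ c • x` of `ℝⁿ`, for `c ≠ 0`. -/
def smulEquiv (n : ℕ) (c : ℝ) (hc : c ≠ 0) : Eucl n ≃L[ℝ] Eucl n :=
  { LinearEquiv.smulOfNeZero ℝ (Eucl n) c hc with
    continuous_toFun := continuous_const_smul c
    continuous_invFun := continuous_const_smul c⁻¹ }

/-- The dilate `x ↦ φ(x/λ)` of a Schwartz function (junk value `φ` for `λ = 0`). -/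
def dilate {n : ℕ} (lam : ℝ) (φ : 𝓢(Eucl n, ℝ)) : 𝓢(Eucl n, ℝ) :=
  if hlam : lam = 0 then φ
  else SchwartzMap.compCLMOfContinuousLinearEquiv ℝ (smulEquiv n lam⁻¹ (inv_ne_zero hlam)) φ

/-- `s` is a scaling bound (at the origin) for the tempered distribution `f`:
`λ^s ⟨f_λ, φ⟩ → 0` as `λ → 0⁺`, where `⟨f_λ, φ⟩ := λ^{−n} ⟨f, φ(·/λ)⟩`. -/
def IsScalingBound (n : ℕ) (f : 𝓢(Eucl n, ℝ) →L[ℝ] ℝ) (s : ℝ) : Prop :=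
  ∀ φ : 𝓢(Eucl n, ℝ),
    Tendsto (fun lam : ℝ => lam ^ s * (lam ^ (-(n : ℝ)) * f (dilate lam φ)))
      (nhdsWithin 0 (Set.Ioi 0)) (nhds 0)

/-- The scaling degree of `f` at the origin: the infimum of its scaling bounds
(in the extended reals). -/
def scalingDegree (n : ℕ) (f : 𝓢(Eucl n, ℝ) →L[ℝ] ℝ) : EReal :=
  sInf {x : EReal | ∃ s : ℝ, x = (s : EReal) ∧ IsScalingBound n f s}

namespace SchwartzMap

variable {E F : Type*} [NormedAddCommGroup E] [NormedSpace ℝ E] [NormedAddCommGroup F]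
  [NormedSpace ℝ F]

/-- The Schwartz seminorms of the differences of a Cauchy sequence become small. -/
theorem exists_seminorm_sub_le_of_cauchySeq {u : ℕ → 𝓢(E, F)} (hu : CauchySeq u) (k n : ℕ)
    {ε : ℝ} (hε : 0 < ε) :
    ∃ N, ∀ i ≥ N, ∀ j ≥ N, SchwartzMap.seminorm ℝ k n (u i - u j) ≤ ε := by
  have hcont : Continuous (SchwartzMap.seminorm ℝ k n : 𝓢(E, F) → ℝ) :=
    (schwartz_withSeminorms ℝ E F).continuous_seminorm (k, n)
  have hsub : Tendsto (fun m : ℕ × ℕ => u m.2 - u m.1) atTop (𝓝 0) := by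
    rw [cauchySeq_iff_tendsto, uniformity_eq_comap_nhds_zero, tendsto_comap_iff] at hu
    exact hu
  have hlim := (hcont.tendsto 0).comp hsub
  rw [map_zero] at hlim
  obtain ⟨⟨a, b⟩, hab⟩ := eventually_atTop.1 (hlim.eventually (ge_mem_nhds hε))
  refine ⟨max a b, fun i hi j hj => hab (j, i) ⟨?_, ?_⟩⟩
  · exact (le_max_left a b).trans hj
  · exact (le_max_right a b).trans hi

/-- Cauchy sequences of Schwartz functions with values in a complete space converge. -/
theorem exists_tendsto_of_cauchySeq [CompleteSpace F] {u : ℕ → 𝓢(E, F)} (hu : CauchySeq u) :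
    ∃ f : 𝓢(E, F), Tendsto u atTop (𝓝 f) := by
  have hC := fun k n (ε : ℝ) (hε : 0 < ε) => exists_seminorm_sub_le_of_cauchySeq hu k n hε
  have hsub : ∀ n i j x, iteratedFDeriv ℝ n (u i - u j : 𝓢(E, F)) x =
      iteratedFDeriv ℝ n (u i) x - iteratedFDeriv ℝ n (u j) x := fun n i j x => by
    have := iteratedFDeriv_sub_apply (𝕜 := ℝ) (i := n) (x := x) ((u i).contDiffAt n)
      ((u j).contDiffAt n)
    exact this
  have hbd : ∀ k n i j x, ‖x‖ ^ k * ‖iteratedFDeriv ℝ n (u i) x - iteratedFDeriv ℝ n (u j) x‖ ≤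
      SchwartzMap.seminorm ℝ k n (u i - u j) := fun k n i j x => by
    rw [← hsub]
    exact le_seminorm ℝ k n _ x
  have hpt : ∀ n x, ∃ y, Tendsto (fun i => iteratedFDeriv ℝ n (u i) x) atTop (𝓝 y) := by
    intro n x
    refine cauchySeq_tendsto_of_complete (Metric.cauchySeq_iff.2 fun ε hε => ?_)
    obtain ⟨N, hN⟩ := hC 0 n (ε / 2) (half_pos hε)
    refine ⟨N, fun i hi j hj => ?_⟩
    have h := (hbd 0 n i j x).trans (hN i hi j hj)
    rw [pow_zero, one_mul] at h
    rw [dist_eq_norm]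
    linarith
  choose P hP using hpt
  have hlim : ∀ k n (ε : ℝ), 0 < ε → ∃ N, ∀ i ≥ N, ∀ x,
      ‖x‖ ^ k * ‖iteratedFDeriv ℝ n (u i) x - P n x‖ ≤ ε := by
    intro k n ε hε
    obtain ⟨N, hN⟩ := hC k n ε hε
    refine ⟨N, fun i hi x => ?_⟩
    refine le_of_tendsto (((hP n x).const_sub _).norm.const_mul _) ?_
    filter_upwards [eventually_ge_atTop N] with j hj
    exact (hbd k n i j x).trans (hN i hi j hj)
  have hunif : ∀ n, TendstoUniformly (fun i => iteratedFDeriv ℝ n (u i)) (P n) atTop := by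
    intro n
    refine Metric.tendstoUniformly_iff.2 fun ε hε => ?_
    obtain ⟨N, hN⟩ := hlim 0 n (ε / 2) (half_pos hε)
    filter_upwards [eventually_ge_atTop N] with i hi x
    have h := hN i hi x
    rw [pow_zero, one_mul] at h
    rw [dist_comm, dist_eq_norm]
    linarith
  have hT : HasFTaylorSeriesUpTo (⊤ : ℕ∞) (fun x => (P 0 x).curry0) (fun x n => P n x) := by
    refine ⟨fun x => rfl, fun m _ x => ?_, fun m _ => ?_⟩
    · refine hasFDerivAt_of_tendstoUniformly (l := atTop)
        (f := fun i => iteratedFDeriv ℝ m (u i))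
        (f' := fun i x => (iteratedFDeriv ℝ (m + 1) (u i) x).curryLeft)
        (g' := fun x => (P (m + 1) x).curryLeft) ?_ ?_ (hP m) x
      · refine Metric.tendstoUniformly_iff.2 fun ε hε => ?_
        filter_upwards [Metric.tendstoUniformly_iff.1 (hunif (m + 1)) ε hε] with i hi x
        have h := hi x
        rwa [← (continuousMultilinearCurryLeftEquiv ℝ (fun _ : Fin (m + 1) => E) F).dist_map]
          at h
      · intro i x
        exact ((u i).smooth ⊤).ftaylorSeries.fderiv m (mod_cast ENat.natCast_lt_top m) x
    · exact (hunif m).continuous (Frequently.of_forall fun i =>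
        ((u i).smooth ⊤).continuous_iteratedFDeriv (mod_cast le_top))
  have hD : ∀ n x, iteratedFDeriv ℝ n (fun x => (P 0 x).curry0) x = P n x := fun n x =>
    (hT.eq_iteratedFDeriv (mod_cast le_top) x).symm
  let f : 𝓢(E, F) :=
    { toFun := fun x => (P 0 x).curry0
      smooth' := hT.contDiff
      decay' := fun k n => by
        obtain ⟨N, hN⟩ := hlim k n 1 one_pos
        refine ⟨SchwartzMap.seminorm ℝ k n (u N) + 1, fun x => ?_⟩
        rw [hD]
        have h₁ := hN N le_rfl x
        have h₂ := le_seminorm ℝ k n (u N) x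
        have h₃ : ‖P n x‖ ≤ ‖iteratedFDeriv ℝ n (u N) x‖ +
            ‖iteratedFDeriv ℝ n (u N) x - P n x‖ := norm_le_norm_add_norm_sub _ _
        have h₄ := mul_le_mul_of_nonneg_left h₃ (pow_nonneg (norm_nonneg x) k)
        linarith }
  refine ⟨f, ((schwartz_withSeminorms ℝ E F).tendsto_nhds_atTop u f).2 ?_⟩
  rintro ⟨k, n⟩ ε hε
  obtain ⟨N, hN⟩ := hlim k n (ε / 2) (half_pos hε)
  refine ⟨N, fun i hi => lt_of_le_of_lt ?_ (half_lt_self hε)⟩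
  refine seminorm_le_bound ℝ k n _ (half_pos hε).le fun x => ?_
  have h := iteratedFDeriv_sub_apply (𝕜 := ℝ) (i := n) (x := x) ((u i).contDiffAt n)
    (f.contDiffAt n)
  have hfx : iteratedFDeriv ℝ n f x = P n x := hD n x
  rw [hfx] at h
  exact (congrArg (fun y => ‖x‖ ^ k * ‖y‖) h).trans_le (hN i hi x)

instance instIsCountablyGeneratedUniformity :
    (uniformity 𝓢(E, F)).IsCountablyGenerated :=
  IsUniformAddGroup.uniformity_countably_generated

instance instCompleteSpace [CompleteSpace F] : CompleteSpace 𝓢(E, F) :=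
  UniformSpace.complete_of_cauchySeq_tendsto fun _ hu => exists_tendsto_of_cauchySeq hu

instance instBarrelledSpace [CompleteSpace F] : BarrelledSpace ℝ 𝓢(E, F) := inferInstance

end SchwartzMap

/-- In a barrelled space, a pointwise null sequence of functionals is null along every
convergent sequence. -/
theorem tendsto_zero_apply_of_tendsto {E : Type*} [AddCommGroup E] [Module ℝ E] [UniformSpace E]
    [IsUniformAddGroup E] [ContinuousSMul ℝ E] [BarrelledSpace ℝ E] {T : ℕ → E →L[ℝ] ℝ}
    (hT : ∀ x, Tendsto (fun k => T k x) atTop (𝓝 0)) {x : ℕ → E} {a : E}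
    (hx : Tendsto x atTop (𝓝 a)) : Tendsto (fun k => T k (x k)) atTop (𝓝 0) := by
  have heq : UniformEquicontinuous ((↑) ∘ T : ℕ → E → ℝ) :=
    PolynormableSpace.banach_steinhaus fun y => (hT y).isVonNBounded_range ℝ
  refine Metric.tendsto_nhds.2 fun ε hε => ?_
  have h₁ := hx.eventually (Metric.equicontinuousAt_iff_right.1
    (heq.equicontinuous a) (ε / 2) (half_pos hε))
  filter_upwards [h₁, Metric.tendsto_nhds.1 (hT a) (ε / 2) (half_pos hε)] with k hk hk'
  have h₂ := hk k
  have h₃ := dist_triangle_left (T k (x k)) 0 (T k a)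
  simp only [Function.comp_apply] at h₂
  linarith

/-- Dilation of Schwartz functions as a continuous linear map. -/
def dilateCLM {n : ℕ} (lam : ℝ) : 𝓢(Eucl n, ℝ) →L[ℝ] 𝓢(Eucl n, ℝ) :=
  if hlam : lam = 0 then ContinuousLinearMap.id ℝ _
  else SchwartzMap.compCLMOfContinuousLinearEquiv ℝ (smulEquiv n lam⁻¹ (inv_ne_zero hlam))

theorem dilateCLM_apply {n : ℕ} (lam : ℝ) (φ : 𝓢(Eucl n, ℝ)) :
    dilateCLM lam φ = dilate lam φ := by
  unfold dilateCLM dilate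
  split_ifs <;> rfl

theorem dilate_apply {n : ℕ} {lam : ℝ} (hlam : lam ≠ 0) (φ : 𝓢(Eucl n, ℝ)) (x : Eucl n) :
    dilate lam φ x = φ (lam⁻¹ • x) := by
  unfold dilate
  rw [dif_neg hlam]
  rfl

/-- The derivatives of `x ↦ g (lam • x) - g 0` are `O(lam)`, with linear growth in `x`. -/
theorem exists_norm_iteratedFDeriv_comp_smul_sub_le {E : Type*} [NormedAddCommGroup E]
    [NormedSpace ℝ E] {g : E → ℝ} (hg : ContDiff ℝ (⊤ : ℕ∞) g) (hgsupp : HasCompactSupport g)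
    (i : ℕ) :
    ∃ C, 0 ≤ C ∧ ∀ lam ∈ Ioc (0 : ℝ) 1, ∀ x,
      ‖iteratedFDeriv ℝ i (fun x => g (lam • x) - g 0) x‖ ≤ C * lam * (1 + ‖x‖) := by
  rcases Nat.eq_zero_or_pos i with rfl | hi
  · obtain ⟨K, hK⟩ := hg.lipschitzWith_of_hasCompactSupport hgsupp (by simp)
    refine ⟨K, K.2, fun lam hlam x => ?_⟩
    rw [norm_iteratedFDeriv_zero, ← dist_eq_norm]
    refine (hK.dist_le_mul _ _).trans ?_
    rw [dist_zero_right, norm_smul, Real.norm_of_nonneg hlam.1.le, ← mul_assoc]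
    exact mul_le_mul_of_nonneg_left (by linarith [norm_nonneg x])
      (mul_nonneg K.2 hlam.1.le)
  · obtain ⟨C, hC⟩ := (hgsupp.iteratedFDeriv (𝕜 := ℝ) i).exists_bound_of_continuous
      (hg.continuous_iteratedFDeriv (mod_cast le_top))
    have hC0 : 0 ≤ C := (norm_nonneg _).trans (hC 0)
    refine ⟨C, hC0, fun lam hlam x => ?_⟩
    have hgi : ContDiff ℝ i g := hg.of_le (mod_cast le_top)
    have hgl : ContDiff ℝ i fun x => g (lam • x) := hgi.comp (contDiff_const_smul lam)
    have hsub := iteratedFDeriv_sub_apply (𝕜 := ℝ) (i := i) (x := x) hgl.contDiffAt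
      (contDiff_const (c := g 0)).contDiffAt
    have hD : iteratedFDeriv ℝ i (fun x => g (lam • x) - g 0) x =
        lam ^ i • iteratedFDeriv ℝ i g (lam • x) := by
      refine hsub.trans ?_
      rw [iteratedFDeriv_comp_const_smul lam hgi, iteratedFDeriv_const_of_ne hi.ne']
      simp
    rw [hD, norm_smul, norm_pow, Real.norm_of_nonneg hlam.1.le]
    have h₁ : lam ^ i ≤ lam := pow_le_of_le_one hlam.1.le hlam.2 hi.ne'
    calc lam ^ i * ‖iteratedFDeriv ℝ i g (lam • x)‖ ≤ lam * C :=
          mul_le_mul h₁ (hC _) (norm_nonneg _) hlam.1.le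
      _ = C * lam * 1 := by ring
      _ ≤ C * lam * (1 + ‖x‖) := mul_le_mul_of_nonneg_left (by linarith [norm_nonneg x])
          (mul_nonneg hC0 hlam.1.le)

/-- Schwartz functions of the form `(g (lam • x) - g 0) * φ x` tend to `0` as `lam → 0⁺`. -/
theorem tendsto_zero_of_eq_comp_smul_sub_mul {E : Type*} [NormedAddCommGroup E]
    [NormedSpace ℝ E] {g : E → ℝ} (hg : ContDiff ℝ (⊤ : ℕ∞) g) (hgsupp : HasCompactSupport g)
    (φ : 𝓢(E, ℝ)) {h : ℝ → 𝓢(E, ℝ)}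
    (hh : ∀ lam, 0 < lam → ∀ x, h lam x = (g (lam • x) - g 0) * φ x) :
    Tendsto h (𝓝[>] 0) (𝓝 0) := by
  refine ((schwartz_withSeminorms ℝ E ℝ).tendsto_nhds h 0).2 ?_
  rintro ⟨k, n⟩ ε hε
  choose C hC0 hC using exists_norm_iteratedFDeriv_comp_smul_sub_le hg hgsupp
  set B : ℝ := ∑ i ∈ Finset.range (n + 1), (n.choose i : ℝ) * C i *
    (SchwartzMap.seminorm ℝ k (n - i) φ + SchwartzMap.seminorm ℝ (k + 1) (n - i) φ) with hB
  have hB0 : 0 ≤ B := Finset.sum_nonneg fun i _ =>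
    mul_nonneg (mul_nonneg (Nat.cast_nonneg _) (hC0 i))
      (add_nonneg (apply_nonneg _ _) (apply_nonneg _ _))
  have hbound : ∀ lam ∈ Ioc (0 : ℝ) 1, SchwartzMap.seminorm ℝ k n (h lam) ≤ lam * B := by
    intro lam hlam
    refine SchwartzMap.seminorm_le_bound ℝ k n _ (mul_nonneg hlam.1.le hB0) fun x => ?_
    have hfun : (h lam : E → ℝ) = fun x => (g (lam • x) - g 0) * φ x := funext (hh lam hlam.1)
    rw [hfun]
    have hgl : ContDiff ℝ (⊤ : ℕ∞) fun x => g (lam • x) - g 0 :=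
      (hg.comp (contDiff_const_smul lam)).sub contDiff_const
    have hmul := norm_iteratedFDeriv_mul_le hgl (φ.smooth ⊤) x (n := n) (mod_cast le_top)
    refine (mul_le_mul_of_nonneg_left hmul (pow_nonneg (norm_nonneg x) k)).trans ?_
    rw [hB, Finset.mul_sum, Finset.mul_sum]
    refine Finset.sum_le_sum fun i _ => ?_
    have h₁ := SchwartzMap.le_seminorm ℝ k (n - i) φ x
    have h₂ := SchwartzMap.le_seminorm ℝ (k + 1) (n - i) φ x
    calc ‖x‖ ^ k * ((n.choose i : ℝ) * ‖iteratedFDeriv ℝ i (fun x => g (lam • x) - g 0) x‖ *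
          ‖iteratedFDeriv ℝ (n - i) φ x‖)
        ≤ ‖x‖ ^ k * ((n.choose i : ℝ) * (C i * lam * (1 + ‖x‖)) *
          ‖iteratedFDeriv ℝ (n - i) φ x‖) := by
          gcongr
          exact hC i lam hlam x
      _ = (n.choose i : ℝ) * C i * lam * (‖x‖ ^ k * ‖iteratedFDeriv ℝ (n - i) φ x‖ +
          ‖x‖ ^ (k + 1) * ‖iteratedFDeriv ℝ (n - i) φ x‖) := by ring
      _ ≤ (n.choose i : ℝ) * C i * lam * (SchwartzMap.seminorm ℝ k (n - i) φ +
          SchwartzMap.seminorm ℝ (k + 1) (n - i) φ) :=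
          mul_le_mul_of_nonneg_left (add_le_add h₁ h₂)
            (mul_nonneg (mul_nonneg (Nat.cast_nonneg _) (hC0 i)) hlam.1.le)
      _ = _ := by ring
  have hlim : Tendsto (fun lam : ℝ => lam * B) (𝓝[>] 0) (𝓝 0) := by
    have h₀ : Tendsto (fun lam : ℝ => lam * B) (𝓝 0) (𝓝 (0 * B)) := tendsto_id.mul_const B
    rw [zero_mul] at h₀
    exact h₀.mono_left nhdsWithin_le_nhds
  filter_upwards [hlim.eventually (gt_mem_nhds hε), Ioc_mem_nhdsGT (zero_lt_one' ℝ)]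
    with lam h₁ h₂
  rw [sub_zero]
  exact (hbound lam h₂).trans_lt h₁

/-- Multiplication by a smooth compactly supported function preserves scaling bounds. -/
theorem IsScalingBound.comp_mul {n : ℕ} {f : 𝓢(Eucl n, ℝ) →L[ℝ] ℝ} {s : ℝ}
    (hf : IsScalingBound n f s) {g : Eucl n → ℝ} (hg : ContDiff ℝ (⊤ : ℕ∞) g)
    (hgsupp : HasCompactSupport g) {M : 𝓢(Eucl n, ℝ) →L[ℝ] 𝓢(Eucl n, ℝ)}
    (hM : ∀ (φ : 𝓢(Eucl n, ℝ)) (x : Eucl n), M φ x = g x * φ x) :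
    IsScalingBound n (f.comp M) s := by
  intro φ
  let ψ : ℝ → 𝓢(Eucl n, ℝ) := fun lam => dilate lam⁻¹ (M (dilate lam φ))
  have hψ : ∀ lam, 0 < lam → ∀ x, ψ lam x = g (lam • x) * φ x := fun lam hlam x => by
    simp only [ψ]
    rw [dilate_apply (inv_ne_zero hlam.ne'), hM, dilate_apply hlam.ne', inv_inv,
      inv_smul_smul₀ hlam.ne']
  have hdil : ∀ lam, 0 < lam → dilate lam (ψ lam) = M (dilate lam φ) := fun lam hlam => by
    ext x
    rw [dilate_apply hlam.ne']
    simp only [ψ]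
    rw [dilate_apply (inv_ne_zero hlam.ne'), inv_inv, smul_inv_smul₀ hlam.ne']
  have hlim : Tendsto ψ (𝓝[>] 0) (𝓝 (g 0 • φ)) := by
    rw [← tendsto_sub_nhds_zero_iff]
    refine tendsto_zero_of_eq_comp_smul_sub_mul hg hgsupp φ fun lam hlam x => ?_
    have : (ψ lam - g 0 • φ) x = ψ lam x - g 0 * φ x := rfl
    rw [this, hψ lam hlam, sub_mul]
  refine tendsto_of_seq_tendsto fun u hu => ?_
  let T : ℕ → 𝓢(Eucl n, ℝ) →L[ℝ] ℝ := fun k =>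
    (u k ^ s * u k ^ (-(n : ℝ))) • f.comp (dilateCLM (u k))
  have hTapp : ∀ k φ, T k φ = u k ^ s * (u k ^ (-(n : ℝ)) * f (dilate (u k) φ)) := fun k φ => by
    rw [← dilateCLM_apply, ← mul_assoc]
    rfl
  have hT : ∀ φ, Tendsto (fun k => T k φ) atTop (𝓝 0) := fun φ =>
    ((hf φ).comp hu).congr fun k => (hTapp k φ).symm
  refine (tendsto_zero_apply_of_tendsto hT (hlim.comp hu)).congr' ?_
  filter_upwards [hu.eventually self_mem_nhdsWithin] with k hk
  rw [hTapp, Function.comp_apply, Function.comp_apply, hdil _ hk]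
  rfl

/-- multiplication by a smooth compactly supported cutoff `g` does not increase
scaling bounds: if `s` is a scaling bound for `f`, then `s` is a scaling bound for `g·f`,
`⟨g·f, φ⟩ := ⟨f, gφ⟩`; consequently `σ(g·f) ≤ σ(f)`. Here `M` is the operator of
multiplication by `g` on Schwartz space. -/
theorem scaling_of_cutoff_mul (n : ℕ) (f : 𝓢(Eucl n, ℝ) →L[ℝ] ℝ)
    (g : Eucl n → ℝ) (hg : ContDiff ℝ (⊤ : ℕ∞) g) (hgsupp : HasCompactSupport g)
    (M : 𝓢(Eucl n, ℝ) →L[ℝ] 𝓢(Eucl n, ℝ))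
    (hM : ∀ (φ : 𝓢(Eucl n, ℝ)) (x : Eucl n), M φ x = g x * φ x) :
    (∀ s : ℝ, IsScalingBound n f s → IsScalingBound n (f.comp M) s) ∧
    scalingDegree n (f.comp M) ≤ scalingDegree n f := by
  have h : ∀ s : ℝ, IsScalingBound n f s → IsScalingBound n (f.comp M) s :=
    fun s hs => hs.comp_mul hg hgsupp hM
  refine ⟨h, sInf_le_sInf ?_⟩
  rintro x ⟨s, hx, hs⟩
  exact ⟨s, hx, h s hs⟩
end
end
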